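/- Let d ≥ 1, let A : ℝ^d → ℝ^d be an orthogonal projection, let F : ℝ^d → ℝ be continuously differentiable with bounded derivative and with values in [0,1], define f = F ∘ A, fix δ > 0 and w ∈ ℝ^d, and define f̂(w) = E_{v ~ Unif(B^d)}[f(w + δ v)]. Let (Ω, 𝔽, P) be a probability space carrying a random vector u distributed uniformly on S^{d-1} and a random variable Z taking values in {0,1} such that the conditional expectation of Z given u satisfies E[Z | u] = 1 − f(w + δ u) almost surely. Define the random update direction h = −Z · A u. Then E[h] = (δ/d) ∇f̂(w). -/

import Mathlib

open MeasureTheory Metric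
open scoped RealInnerProductSpace

/-- The uniform (normalized Lebesgue) probability measure on the closed unit ball
of `ℝ^d`. -/
noncomputable def ballUniform (d : ℕ) : Measure (EuclideanSpace ℝ (Fin d)) :=
  (volume (closedBall (0 : EuclideanSpace ℝ (Fin d)) 1))⁻¹ •
    volume.restrict (closedBall (0 : EuclideanSpace ℝ (Fin d)) 1)

/-- The uniform (normalized surface) probability measure on the unit sphere of `ℝ^d`,
viewed as a measure on the ambient space `ℝ^d`. -/
noncomputable def sphereUniform' (d : ℕ) : Measure (EuclideanSpace ℝ (Fin d)) :=
  Measure.map (Subtype.val)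
    ((((volume (α := EuclideanSpace ℝ (Fin d))).toSphere Set.univ)⁻¹ •
      (volume (α := EuclideanSpace ℝ (Fin d))).toSphere :
        Measure (sphere (0 : EuclideanSpace ℝ (Fin d)) 1)))

/-- The smoothed function `f̂(w) = 𝔼_{v ~ Unif(B^d)}[f (w + δ v)]`. -/
noncomputable def smoothed (d : ℕ) (δ : ℝ) (f : EuclideanSpace ℝ (Fin d) → ℝ)
    (w : EuclideanSpace ℝ (Fin d)) : ℝ :=
  ∫ v, f (w + δ • v) ∂(ballUniform d)

open Set in
lemma polar_aux {E : Type*} [NormedAddCommGroup E] [NormedSpace ℝ E] [MeasurableSpace E]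
    [BorelSpace E] [FiniteDimensional ℝ E] [Nontrivial E] (μ : Measure E) [μ.IsAddHaarMeasure]
    (h : E → ℝ) (hh : Continuous h) (R : ℝ) (hR : 0 < R) :
    ∫ x in closedBall (0 : E) R, h x ∂μ
      = ∫ r in (0 : ℝ)..R, r ^ (Module.finrank ℝ E - 1) *
          ∫ s : sphere (0 : E) 1, h (r • (s : E)) ∂μ.toSphere := by
  set n := Module.finrank ℝ E - 1 with hn
  set H : E → ℝ := (closedBall (0 : E) R).indicator h with hH
  have hHi : Integrable H μ := by
    rw [hH, integrable_indicator_iff measurableSet_closedBall]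
    exact hh.continuousOn.integrableOn_compact (isCompact_closedBall _ _)
  have hmp := μ.measurePreserving_homeomorphUnitSphereProd
  have hkey : ∀ x : ({0}ᶜ : Set E), H x =
      (fun p : sphere (0 : E) 1 × Ioi (0 : ℝ) => H ((p.2 : ℝ) • (p.1 : E)))
        (homeomorphUnitSphereProd E x) := by
    intro x
    have := congrArg Subtype.val ((homeomorphUnitSphereProd E).symm_apply_apply x)
    simp only [homeomorphUnitSphereProd_symm_apply_coe] at this
    simp only [this]
  have hint : Integrable (fun p : sphere (0 : E) 1 × Ioi (0 : ℝ) => H ((p.2 : ℝ) • (p.1 : E)))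
      (μ.toSphere.prod (Measure.volumeIoiPow n)) := by
    rw [← hmp.integrable_comp_emb (Homeomorph.measurableEmbedding _)]
    have : Integrable (fun x : ({0}ᶜ : Set E) => H x) (μ.comap (↑)) := by
      have := (integrableOn_iff_comap_subtypeVal (f := H) (μ := μ)
        (measurableSet_singleton (0 : E)).compl).1 hHi.integrableOn
      exact this
    refine this.congr (Filter.Eventually.of_forall fun x => ?_)
    exact hkey x
  have hK : ∀ r : ℝ, 0 < r → ∫ s : sphere (0 : E) 1, H (r • (s : E)) ∂μ.toSphere
      = (Iic R).indicator (fun r => ∫ s : sphere (0 : E) 1, h (r • (s : E)) ∂μ.toSphere) r := by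
    intro r hr
    by_cases hrR : r ≤ R
    · rw [indicator_of_mem (by exact hrR)]
      congr 1; ext s
      rw [hH, indicator_of_mem]
      simp [norm_smul, abs_of_pos hr, hrR]
    · rw [indicator_of_notMem (by exact hrR)]
      rw [← integral_zero (sphere (0:E) 1) ℝ (μ := μ.toSphere)]
      congr 1; ext s
      rw [hH, indicator_of_notMem]
      simpa [norm_smul, abs_of_pos hr] using hrR
  calc ∫ x in closedBall (0 : E) R, h x ∂μ = ∫ x, H x ∂μ := by
        rw [hH, integral_indicator measurableSet_closedBall]
    _ = ∫ x : ({(0)}ᶜ : Set E), H x ∂(μ.comap (↑)) := by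
      rw [integral_subtype_comap (measurableSet_singleton _).compl fun x ↦ H x,
        restrict_compl_singleton]
    _ = ∫ p, H ((p.2 : ℝ) • (p.1 : E)) ∂(μ.toSphere.prod (Measure.volumeIoiPow n)) := by
      rw [← hmp.integral_comp (Homeomorph.measurableEmbedding _)]
      exact integral_congr_ae (Filter.Eventually.of_forall hkey)
    _ = ∫ r : Ioi (0 : ℝ), ∫ s : sphere (0 : E) 1, H ((r : ℝ) • (s : E)) ∂μ.toSphere
          ∂(Measure.volumeIoiPow n) := integral_prod_symm _ hint
    _ = ∫ r in Ioi (0 : ℝ), (Iic R).indicator (fun r => r ^ n *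
          ∫ s : sphere (0 : E) 1, h (r • (s : E)) ∂μ.toSphere) r := by
      simp only [Measure.volumeIoiPow, ENNReal.ofReal]
      rw [integral_withDensity_eq_integral_smul,
        integral_subtype_comap measurableSet_Ioi fun a ↦ Real.toNNReal (a ^ n) •
          ∫ s : sphere (0 : E) 1, H (a • (s : E)) ∂μ.toSphere,
        setIntegral_congr_fun measurableSet_Ioi fun x hx ↦ ?_]
      · rw [hK x hx, NNReal.smul_def, Real.coe_toNNReal _ (pow_nonneg hx.out.le _)]
        by_cases hxR : x ∈ Iic R
        · simp only [indicator_of_mem hxR, smul_eq_mul]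
        · simp only [indicator_of_notMem hxR, smul_eq_mul, mul_zero]
      · exact (measurable_subtype_coe.pow_const _).real_toNNReal
    _ = _ := by
      rw [setIntegral_indicator measurableSet_Iic, Ioi_inter_Iic,
        intervalIntegral.integral_of_le hR.le]

/-- ramp -/
lemma ramp_lip {E : Type*} [NormedAddCommGroup E] (R : ℝ) (hR : 0 < R) :
    LipschitzWith (2 * R).toNNReal (fun x : E => max 0 (R ^ 2 - ‖x‖ ^ 2)) := by
  refine LipschitzWith.of_dist_le_mul fun x y => ?_
  rw [Real.coe_toNNReal _ (by positivity), Real.dist_eq, dist_eq_norm]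
  have key : ∀ x : E, max 0 (R ^ 2 - ‖x‖ ^ 2) = R ^ 2 - (min ‖x‖ R) ^ 2 := by
    intro x
    have := norm_nonneg x
    rcases le_total ‖x‖ R with h | h
    · rw [min_eq_left h, max_eq_right]; nlinarith
    · rw [min_eq_right h, max_eq_left]; · ring
      nlinarith
  rw [key, key]
  have h1 : |min ‖x‖ R - min ‖y‖ R| ≤ ‖x - y‖ :=
    (abs_min_sub_min_le_max _ _ _ _).trans (by simpa using abs_norm_sub_norm_le x y)
  have h2 : |min ‖x‖ R + min ‖y‖ R| ≤ 2 * R := by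
    have := norm_nonneg x
    have := norm_nonneg y
    rw [abs_of_nonneg (by positivity)]
    linarith [min_le_right ‖x‖ R, min_le_right ‖y‖ R]
  calc |R ^ 2 - (min ‖x‖ R) ^ 2 - (R ^ 2 - (min ‖y‖ R) ^ 2)|
      = |min ‖x‖ R + min ‖y‖ R| * |min ‖x‖ R - min ‖y‖ R| := by
        rw [← abs_mul, ← abs_neg]; ring_nf
    _ ≤ 2 * R * ‖x - y‖ := by gcongr

lemma ibp_aux {E : Type*} [NormedAddCommGroup E] [InnerProductSpace ℝ E] [MeasurableSpace E]
    [BorelSpace E] [FiniteDimensional ℝ E] [Nontrivial E] (μ : Measure E) [μ.IsAddHaarMeasure]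
    (g : E → ℝ) (hg : ContDiff ℝ 1 g) (C : NNReal) (hL : LipschitzWith C g) (e : E)
    (R : ℝ) (hR : 0 < R) :
    ∫ x in closedBall (0 : E) R, (R ^ 2 - ‖x‖ ^ 2) * fderiv ℝ g x e ∂μ
     = ∫ x in closedBall (0 : E) R, 2 * (g x * ⟪x, e⟫) ∂μ := by
  have hcs : HasCompactSupport (fun x : E => max 0 (R ^ 2 - ‖x‖ ^ 2)) := by
    refine HasCompactSupport.intro (isCompact_closedBall (0 : E) R) fun x hx => ?_
    have : R < ‖x‖ := by simpa using hx
    apply max_eq_left; nlinarith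
  have := LipschitzWith.integral_lineDeriv_mul_eq (μ := μ) hL (ramp_lip (E := E) R hR) hcs e
  rw [← integral_indicator measurableSet_closedBall, ← integral_indicator measurableSet_closedBall]
  convert this using 1
  · congr 1; ext x
    rw [(hg.differentiable one_ne_zero x).lineDeriv_eq_fderiv]
    by_cases hx : x ∈ closedBall (0 : E) R
    · have h' : ‖x‖ ≤ R := by simpa using hx
      rw [Set.indicator_of_mem hx, max_eq_right, mul_comm]
      nlinarith [norm_nonneg x]
    · have h' : R < ‖x‖ := by simpa using hx
      rw [Set.indicator_of_notMem hx, max_eq_left, mul_zero]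
      nlinarith [norm_nonneg x]
  · apply integral_congr_ae
    have hs : ∀ᵐ x ∂μ, x ∉ sphere (0 : E) R := by
      exact measure_eq_zero_iff_ae_notMem.1 (Measure.addHaar_sphere μ (0 : E) R)
    filter_upwards [hs] with x hx
    have hne : ‖x‖ ≠ R := by simpa using hx
    rcases lt_or_gt_of_ne hne with h | h
    · rw [Set.indicator_of_mem (by simpa using h.le)]
      have hd : HasFDerivAt (fun x : E => max 0 (R ^ 2 - ‖x‖ ^ 2)) (-(2 • innerSL ℝ x)) x := by
        have h1 : HasFDerivAt (fun x : E => R ^ 2 - ‖x‖ ^ 2) (-(2 • innerSL ℝ x)) x :=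
          ((hasStrictFDerivAt_norm_sq x).hasFDerivAt).const_sub _
        refine h1.congr_of_eventuallyEq ?_
        filter_upwards [continuous_norm.continuousAt.eventually_lt continuousAt_const h] with y hy
        apply max_eq_right; nlinarith [norm_nonneg y]
      rw [hd.differentiableAt.lineDeriv_eq_fderiv, hd.fderiv]
      simp
      ring
    · rw [Set.indicator_of_notMem (by simpa using h)]
      have hd : HasFDerivAt (fun x : E => max 0 (R ^ 2 - ‖x‖ ^ 2)) (0 : E →L[ℝ] ℝ) x := by
        refine (hasFDerivAt_const (0 : ℝ) x).congr_of_eventuallyEq ?_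
        filter_upwards [continuousAt_const.eventually_lt continuous_norm.continuousAt h] with y hy
        apply max_eq_left; nlinarith [norm_nonneg y]
      rw [hd.differentiableAt.lineDeriv_eq_fderiv, hd.fderiv]
      simp

lemma div_aux {E : Type*} [NormedAddCommGroup E] [InnerProductSpace ℝ E] [MeasurableSpace E]
    [BorelSpace E] [FiniteDimensional ℝ E] [Nontrivial E] (μ : Measure E) [μ.IsAddHaarMeasure]
    (g : E → ℝ) (hg : ContDiff ℝ 1 g) (C : NNReal) (hL : LipschitzWith C g) (e : E) :
    ∫ x in closedBall (0 : E) 1, fderiv ℝ g x e ∂μ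
     = ∫ s : sphere (0 : E) 1, g s * ⟪(s : E), e⟫ ∂μ.toSphere := by
  set n := Module.finrank ℝ E - 1 with hn
  have hg' : Continuous (fun x => fderiv ℝ g x e) :=
    (hg.continuous_fderiv one_ne_zero).clm_apply continuous_const
  have hgc : Continuous g := hg.continuous
  have hcont : ∀ h : E → ℝ, Continuous h →
      Continuous (fun r : ℝ => ∫ s : sphere (0 : E) 1, h (r • (s : E)) ∂μ.toSphere) := by
    intro h hh
    have : Continuous (fun r : ℝ => ∫ s in (Set.univ : Set (sphere (0 : E) 1)),
        h (r • (s : E)) ∂μ.toSphere) := by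
      apply continuous_parametric_integral_of_continuous _ isCompact_univ
      simp only [Function.uncurry_def]
      fun_prop
    simpa using this
  set K : ℝ → ℝ := fun r => ∫ s : sphere (0 : E) 1, fderiv ℝ g (r • (s : E)) e ∂μ.toSphere with hK
  set H : ℝ → ℝ := fun r => ∫ s : sphere (0 : E) 1, 2 * (g (r • (s : E)) * ⟪r • (s : E), e⟫)
    ∂μ.toSphere with hH
  have hKc : Continuous K := hcont _ hg'
  have hHc : Continuous H := hcont (fun x => 2 * (g x * ⟪x, e⟫)) (by fun_prop)
  have key : ∀ R : ℝ, 0 < R →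
      R ^ 2 * (∫ r in (0 : ℝ)..R, r ^ n * K r) - ∫ r in (0 : ℝ)..R, r ^ n * (r ^ 2 * K r)
        = ∫ r in (0 : ℝ)..R, r ^ n * H r := by
    intro R hR
    have := ibp_aux μ g hg C hL e R hR
    rw [polar_aux μ _ (by fun_prop) R hR, polar_aux μ _ (by fun_prop) R hR] at this
    rw [← this, ← intervalIntegral.integral_const_mul, ← intervalIntegral.integral_sub]
    · congr 1; ext r
      have : ∀ s : sphere (0 : E) 1, (R ^ 2 - ‖r • (s : E)‖ ^ 2) * fderiv ℝ g (r • (s : E)) e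
          = (R ^ 2 - r ^ 2) * fderiv ℝ g (r • (s : E)) e := by
        intro s
        simp [norm_smul]
      simp only [this]
      rw [integral_const_mul]
      simp only [hK]
      ring
    · exact Continuous.intervalIntegrable (by fun_prop) _ _
    · exact Continuous.intervalIntegrable (by fun_prop) _ _
  have d1 : HasDerivAt (fun R : ℝ => R ^ 2 * (∫ r in (0 : ℝ)..R, r ^ n * K r)
      - ∫ r in (0 : ℝ)..R, r ^ n * (r ^ 2 * K r))
      (2 * ∫ r in (0 : ℝ)..1, r ^ n * K r) 1 := by
    have a1 : HasDerivAt (fun R : ℝ => ∫ r in (0 : ℝ)..R, r ^ n * K r) (1 ^ n * K 1) 1 :=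
      (show Continuous (fun r : ℝ => r ^ n * K r) by fun_prop).integral_hasStrictDerivAt 0 1
        |>.hasDerivAt
    have a2 : HasDerivAt (fun R : ℝ => ∫ r in (0 : ℝ)..R, r ^ n * (r ^ 2 * K r))
        (1 ^ n * (1 ^ 2 * K 1)) 1 :=
      (show Continuous (fun r : ℝ => r ^ n * (r ^ 2 * K r)) by
        fun_prop).integral_hasStrictDerivAt 0 1 |>.hasDerivAt
    have e1 : (2 * ∫ r in (0 : ℝ)..1, r ^ n * K r) = (((2 : ℕ) : ℝ) * 1 ^ (2 - 1) *
        ∫ r in (0 : ℝ)..1, r ^ n * K r) + 1 ^ 2 * (1 ^ n * K 1) - 1 ^ n * (1 ^ 2 * K 1) := by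
      norm_num
    rw [e1]
    exact ((hasDerivAt_pow 2 (1 : ℝ)).mul a1).sub a2
  have d2 : HasDerivAt (fun R : ℝ => R ^ 2 * (∫ r in (0 : ℝ)..R, r ^ n * K r)
      - ∫ r in (0 : ℝ)..R, r ^ n * (r ^ 2 * K r)) (1 ^ n * H 1) 1 := by
    have a1 : HasDerivAt (fun R : ℝ => ∫ r in (0 : ℝ)..R, r ^ n * H r) (1 ^ n * H 1) 1 :=
      (show Continuous (fun r : ℝ => r ^ n * H r) by fun_prop).integral_hasStrictDerivAt 0 1
        |>.hasDerivAt
    refine a1.congr_of_eventuallyEq ?_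
    filter_upwards [lt_mem_nhds (zero_lt_one' ℝ)] with R hR using key R hR
  have h := d1.unique d2
  rw [polar_aux μ _ hg' 1 one_pos]
  simp only [hH, one_pow, one_mul, one_smul, integral_const_mul] at h
  linarith

lemma smoothed_grad (d : ℕ)
    (f : EuclideanSpace ℝ (Fin d) → ℝ) (hf : ContDiff ℝ 1 f)
    (C : ℝ) (hbdd : ∀ x, ‖fderiv ℝ f x‖ ≤ C)
    (δ : ℝ) (w e : EuclideanSpace ℝ (Fin d)) :
    ⟪gradient (smoothed d δ f) w, e⟫ =
      (volume.real (closedBall (0 : EuclideanSpace ℝ (Fin d)) 1))⁻¹ *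
        ∫ v in closedBall (0 : EuclideanSpace ℝ (Fin d)) 1, fderiv ℝ f (w + δ • v) e := by
  have hfc := hf.continuous
  have hf' := hf.continuous_fderiv one_ne_zero
  have hD : HasFDerivAt (fun w => ∫ v in closedBall (0 : EuclideanSpace ℝ (Fin d)) 1,
      f (w + δ • v)) (∫ v in closedBall (0 : EuclideanSpace ℝ (Fin d)) 1,
      fderiv ℝ f (w + δ • v)) w := by
    have : IsFiniteMeasure (volume.restrict (closedBall (0 : EuclideanSpace ℝ (Fin d)) 1)) :=
      ⟨by simpa using measure_closedBall_lt_top⟩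
    refine hasFDerivAt_integral_of_dominated_of_fderiv_le (s := Set.univ) (bound := fun _ => C)
      (F' := fun w v => fderiv ℝ f (w + δ • v)) Filter.univ_mem ?_ ?_ ?_ ?_ ?_ ?_
    · exact Filter.Eventually.of_forall fun x =>
        (show Continuous fun v => f (x + δ • v) by fun_prop).aestronglyMeasurable
    · exact (show Continuous fun v => f (w + δ • v) by
        fun_prop).continuousOn.integrableOn_compact (isCompact_closedBall _ _)
    · exact (show Continuous fun v => fderiv ℝ f (w + δ • v) by
        fun_prop).aestronglyMeasurable
    · exact Filter.Eventually.of_forall fun v x _ => hbdd _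
    · exact integrable_const _
    · refine Filter.Eventually.of_forall fun v x _ => ?_
      exact (hasFDerivAt_comp_add_right (δ • v)).2 (hf.differentiable one_ne_zero (x + δ • v)).hasFDerivAt
  have hsm : smoothed d δ f = fun w =>
      (volume.real (closedBall (0 : EuclideanSpace ℝ (Fin d)) 1))⁻¹ *
      ∫ v in closedBall (0 : EuclideanSpace ℝ (Fin d)) 1, f (w + δ • v) := by
    ext x
    simp [smoothed, ballUniform, integral_smul_measure, Measure.real]
  have h2 := hD.const_mul (volume.real (closedBall (0 : EuclideanSpace ℝ (Fin d)) 1))⁻¹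
  rw [← hsm] at h2
  rw [gradient, InnerProductSpace.toDual_symm_apply, h2.fderiv]
  simp only [smul_apply, smul_eq_mul]
  rw [ContinuousLinearMap.integral_apply]
  exact (show Continuous fun v => fderiv ℝ f (w + δ • v) by
        fun_prop).continuousOn.integrableOn_compact (isCompact_closedBall _ _)

/-- **Theorem 1 of the paper (unbiasedness of DBGD-DSP's projected gradient).**
Let `A` be an orthogonal projection of `ℝ^d`, `F` continuously differentiable with
bounded derivative and values in `[0,1]`, `f = F ∘ A`, and `f̂` the ball-smoothed
version of `f`. On a probability space carrying a uniformly-on-the-sphere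
distributed random vector `u` and a `{0,1}`-valued random variable `Z` with
`𝔼[Z ∣ u] = 1 - f (w + δ u)` a.s., the update direction `h = -Z • A u` satisfies
`𝔼[h] = (δ / d) • ∇ f̂ (w)`. -/
theorem expectation_projected_update_eq_smoothed_gradient
    (d : ℕ) (hd : 1 ≤ d)
    (A : EuclideanSpace ℝ (Fin d) →ₗ[ℝ] EuclideanSpace ℝ (Fin d))
    (hidem : A ∘ₗ A = A)
    (hsa : ∀ x y : EuclideanSpace ℝ (Fin d), ⟪A x, y⟫ = ⟪x, A y⟫)
    (F : EuclideanSpace ℝ (Fin d) → ℝ) (hF : ContDiff ℝ 1 F)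
    (C : ℝ) (hbdd : ∀ x, ‖fderiv ℝ F x‖ ≤ C)
    (hF01 : ∀ x, F x ∈ Set.Icc (0 : ℝ) 1)
    (δ : ℝ) (hδ : 0 < δ) (w : EuclideanSpace ℝ (Fin d))
    {Ω : Type*} [MeasurableSpace Ω] (P : Measure Ω) [IsProbabilityMeasure P]
    (u : Ω → EuclideanSpace ℝ (Fin d)) (hu : Measurable u)
    (hlaw : Measure.map u P = sphereUniform' d)
    (Z : Ω → ℝ) (hZmeas : Measurable Z) (hZ01 : ∀ ω, Z ω = 0 ∨ Z ω = 1)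
    (hZcond : P[Z | MeasurableSpace.comap u (inferInstance : MeasurableSpace (EuclideanSpace ℝ (Fin d)))]
      =ᵐ[P] fun ω => 1 - (F ∘ A) (w + δ • u ω)) :
    (∫ ω, (-(Z ω)) • A (u ω) ∂P) = (δ / d) • gradient (smoothed d δ (F ∘ A)) w := by
  have : Nonempty (Fin d) := ⟨⟨0, hd⟩⟩
  have : Nontrivial (EuclideanSpace ℝ (Fin d)) := inferInstance
  set A' : (EuclideanSpace ℝ (Fin d)) →L[ℝ] (EuclideanSpace ℝ (Fin d)) := A.toContinuousLinearMap with hA'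
  have hAA : ∀ x, A' x = A x := fun x => rfl
  set f : (EuclideanSpace ℝ (Fin d)) → ℝ := F ∘ A with hf
  have hfA : f = F ∘ A' := rfl
  have hfs : ContDiff ℝ 1 f := by rw [hfA]; exact hF.comp A'.contDiff
  have hfd : ∀ x, HasFDerivAt f ((fderiv ℝ F (A' x)).comp A') x := fun x =>
    ((hF.differentiable one_ne_zero (A' x)).hasFDerivAt).comp x A'.hasFDerivAt
  have hfc := hfs.continuous
  have hC0 : 0 ≤ C := (norm_nonneg _).trans (hbdd 0)
  have hfb : ∀ x, ‖fderiv ℝ f x‖ ≤ C * ‖A'‖ := by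
    intro x
    rw [(hfd x).fderiv]
    exact (ContinuousLinearMap.opNorm_comp_le _ _).trans (by gcongr; exact hbdd _)
  have hfA2 : ∀ x e, fderiv ℝ f x (A e) = fderiv ℝ f x e := by
    intro x e
    rw [(hfd x).fderiv]
    have : A (A e) = A e := LinearMap.congr_fun hidem e
    simp [hAA, this]
  -- the rescaled function
  set g : (EuclideanSpace ℝ (Fin d)) → ℝ := fun v => f (w + δ • v) - 1 with hg
  have hgs : ContDiff ℝ 1 g := by rw [hg]; fun_prop
  have hgd : ∀ v, HasFDerivAt g (δ • fderiv ℝ f (w + δ • v)) v := by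
    intro v
    have h1 : HasFDerivAt (fun v : (EuclideanSpace ℝ (Fin d)) => w + δ • v) (δ • ContinuousLinearMap.id ℝ (EuclideanSpace ℝ (Fin d))) v :=
      ((hasFDerivAt_id v).const_smul δ).const_add w
    have h2 := (((hfs.differentiable one_ne_zero (w + δ • v)).hasFDerivAt).comp v h1).sub_const 1
    have e1 : δ • fderiv ℝ f (w + δ • v) = (fderiv ℝ f (w + δ • v)).comp
        (δ • ContinuousLinearMap.id ℝ (EuclideanSpace ℝ (Fin d))) := by
      refine ContinuousLinearMap.ext fun y => ?_
      simp
    rw [e1]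
    exact h2
  have hgL : LipschitzWith (δ * (C * ‖A'‖)).toNNReal g := by
    refine lipschitzWith_of_nnnorm_fderiv_le (𝕜 := ℝ) (hgs.differentiable one_ne_zero) fun x => ?_
    rw [← NNReal.coe_le_coe, coe_nnnorm, Real.coe_toNNReal _ (by positivity), (hgd x).fderiv,
      norm_smul, Real.norm_of_nonneg hδ.le]
    exact mul_le_mul_of_nonneg_left (hfb _) hδ.le
  -- bounds on u
  have hu1 : ∀ᵐ ω ∂P, ‖u ω‖ = 1 := by
    have : ∀ᵐ x ∂(Measure.map u P), ‖x‖ = 1 := by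
      rw [hlaw, sphereUniform', ae_map_iff measurable_subtype_coe.aemeasurable
        (measurableSet_eq_fun measurable_norm measurable_const)]
      exact Filter.Eventually.of_forall fun s => by simp
    exact ae_of_ae_map hu.aemeasurable this
  have hZb : ∀ ω, ‖Z ω‖ ≤ 1 := fun ω => by rcases hZ01 ω with h | h <;> simp [h]
  have hZi : Integrable Z P :=
    Integrable.of_bound hZmeas.aestronglyMeasurable 1 (Filter.Eventually.of_forall hZb)
  have hAu : Measurable fun ω => A (u ω) := A'.continuous.measurable.comp hu
  have hint : Integrable (fun ω => (-(Z ω)) • A (u ω)) P := by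
    refine Integrable.of_bound (hZmeas.neg.smul hAu).aestronglyMeasurable ‖A'‖ ?_
    filter_upwards [hu1] with ω hω
    rw [norm_smul, norm_neg]
    have := A'.le_opNorm (u ω)
    rw [hω, mul_one, hAA] at this
    nlinarith [hZb ω, norm_nonneg (Z ω), norm_nonneg (A (u ω))]
  refine ext_inner_right ℝ fun e => ?_
  rw [real_inner_smul_left, smoothed_grad d f hfs _ hfb, ← real_inner_comm,
    ← integral_inner hint]
  -- conditional expectation
  have hm := hu.comap_le
  have hq : Measurable fun x : (EuclideanSpace ℝ (Fin d)) => ⟪x, A e⟫ := by fun_prop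
  have hqm : StronglyMeasurable[MeasurableSpace.comap u inferInstance]
      (fun ω => ⟪u ω, A e⟫) :=
    (hq.comp (comap_measurable u)).stronglyMeasurable
  have hpull := condExp_stronglyMeasurable_mul_of_bound hm hqm hZi ‖A e‖ (by
    filter_upwards [hu1] with ω hω
    simpa [hω] using norm_inner_le_norm (𝕜 := ℝ) (u ω) (A e))
  have hstep : ∫ ω, ⟪e, (-(Z ω)) • A (u ω)⟫ ∂P = ∫ ω, g (u ω) * ⟪u ω, A e⟫ ∂P := by
    have h1 : ∫ ω, ⟪u ω, A e⟫ * Z ω ∂P = ∫ ω, ⟪u ω, A e⟫ * (1 - f (w + δ • u ω)) ∂P := by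
      calc ∫ ω, ⟪u ω, A e⟫ * Z ω ∂P = _ := (integral_condExp hm).symm
        _ = _ := integral_congr_ae (by
          filter_upwards [hpull, hZcond] with ω h1 h2
          refine h1.trans ?_
          rw [Pi.mul_apply, h2])
    calc ∫ ω, ⟪e, (-(Z ω)) • A (u ω)⟫ ∂P = ∫ ω, -(⟪u ω, A e⟫ * Z ω) ∂P := by
          congr 1; ext ω
          rw [real_inner_smul_right, real_inner_comm, hsa]; ring
      _ = ∫ ω, -(⟪u ω, A e⟫ * (1 - f (w + δ • u ω))) ∂P := by
          rw [integral_neg, h1, integral_neg]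
      _ = _ := by congr 1; ext ω; simp only [hg]; ring
  have hgc := hgs.continuous
  have hsph : ∫ ω, g (u ω) * ⟪u ω, A e⟫ ∂P
      = ((volume (α := (EuclideanSpace ℝ (Fin d)))).toSphere.real Set.univ)⁻¹ *
        ∫ s : sphere (0 : (EuclideanSpace ℝ (Fin d))) 1, g s * ⟪(s : (EuclideanSpace ℝ (Fin d))), A e⟫ ∂(volume (α := (EuclideanSpace ℝ (Fin d)))).toSphere := by
    have hc : Continuous fun x : (EuclideanSpace ℝ (Fin d)) => g x * ⟪x, A e⟫ := by fun_prop
    rw [← integral_map (f := fun x : (EuclideanSpace ℝ (Fin d)) => g x * ⟪x, A e⟫) hu.aemeasurable hc.aestronglyMeasurable,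
      hlaw, sphereUniform',
      integral_map measurable_subtype_coe.aemeasurable hc.aestronglyMeasurable,
      integral_smul_measure]
    simp [Measure.real]
  rw [hstep, hsph, ← div_aux volume g hgs _ hgL (A e), Measure.toSphere_real_apply_univ]
  have hgA : ∀ v, fderiv ℝ g v (A e) = δ * fderiv ℝ f (w + δ • v) e := by
    intro v
    rw [(hgd v).fderiv, ← hfA2 _ e]; simp
  simp only [hgA]
  rw [integral_const_mul]
  have hvol : volume.real (ball (0 : (EuclideanSpace ℝ (Fin d))) 1) = volume.real (closedBall (0 : (EuclideanSpace ℝ (Fin d))) 1) := by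
    rw [Measure.real, Measure.real, Measure.addHaar_closedBall_eq_addHaar_ball]
  rw [hvol, finrank_euclideanSpace_fin, mul_inv]
  ring
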